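/- For every δ > 0 and every real ε with 0 < ε ≤ 10^{-3} there exists N(δ) such that the following holds for every n ≥ N(δ). Let t be an integer with δn ≤ t ≤ (2n−6)/9 + 1, set N = ex(n,(t+1)K3) + 2, let χ : E(K_n) → {1,…,N} be a surjective edge-coloring admitting no rainbow copy of (t+2)K3, let H ⊆ K_n be a representative graph of χ, and let (T, M, I) be a maximal tiling triple of H with ideal partition (T1, T2, T3, T4) satisfying |T1| ∈ [t−1, t+1], |M| ∈ ((n−3(t+1))/2 − √(2n)/2, (n−3(t+1))/2], and |I| < √(2n). Then at most two triangles of T1 are seen by fewer than εn edges of M. -/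

import Mathlib

open Finset

/-- `H` contains `k` pairwise vertex-disjoint triangles. -/
def HasKDisjointTriangles {n : ℕ} (H : SimpleGraph (Fin n)) (k : ℕ) : Prop :=
  ∃ T : Finset (Finset (Fin n)), T.card = k ∧ (∀ s ∈ T, H.IsNClique 3 s) ∧
    (T : Set (Finset (Fin n))).Pairwise fun s₁ s₂ => Disjoint s₁ s₂

/-- Under the edge-coloring `χ`, the graph `H` contains a rainbow copy of `k`
pairwise vertex-disjoint triangles. -/
def HasRainbowKTriangles {n : ℕ} (H : SimpleGraph (Fin n)) (χ : Sym2 (Fin n) → ℕ)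
    (k : ℕ) : Prop :=
  ∃ T : Finset (Finset (Fin n)), T.card = k ∧ (∀ s ∈ T, H.IsNClique 3 s) ∧
    ((T : Set (Finset (Fin n))).Pairwise fun s₁ s₂ => Disjoint s₁ s₂) ∧
    Set.InjOn χ {e : Sym2 (Fin n) | ¬ e.IsDiag ∧ ∃ s ∈ T, ∀ x ∈ e, x ∈ s}

/-- `χ` is a surjective edge-coloring of `K_n` with colors `{1, …, N}`. -/
def IsSurjColoring (n N : ℕ) (χ : Sym2 (Fin n) → ℕ) : Prop :=
  (∀ e : Sym2 (Fin n), ¬ e.IsDiag → χ e ∈ Finset.Icc 1 N) ∧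
  (∀ c ∈ Finset.Icc 1 N, ∃ e : Sym2 (Fin n), ¬ e.IsDiag ∧ χ e = c)

/-- `ex(n, kK₃)`: the maximum number of edges of an `n`-vertex graph containing no `k`
pairwise vertex-disjoint triangles. -/
noncomputable def exTriangles (n k : ℕ) : ℕ :=
  sSup {m : ℕ | ∃ H : SimpleGraph (Fin n), ¬ HasKDisjointTriangles H k ∧
    H.edgeSet.ncard = m}

/-- `H` is a representative graph of the `N`-coloring `χ`: it is rainbow and has
exactly `N` edges. -/
def IsRepGraph {n : ℕ} (χ : Sym2 (Fin n) → ℕ) (N : ℕ) (H : SimpleGraph (Fin n)) : Prop :=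
  H.edgeSet.ncard = N ∧ Set.InjOn χ H.edgeSet

/-- The edge `e` (a set of two vertices) sees the vertex `w` of the triangle `s`:
`w ∈ s` and both endpoints of `e` are adjacent to `w` in `H`. -/
def seesAt {n : ℕ} (H : SimpleGraph (Fin n)) (e s : Finset (Fin n)) (w : Fin n) : Prop :=
  w ∈ s ∧ ∀ u ∈ e, H.Adj u w

/-- The edge `e` sees the triangle `s`. -/
def sees {n : ℕ} (H : SimpleGraph (Fin n)) (e s : Finset (Fin n)) : Prop :=
  ∃ w, seesAt H e s w

/-- The vertex `p` sees the triangle `s`: `p` is adjacent to two distinct vertices of `s`. -/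
def vertexSees {n : ℕ} (H : SimpleGraph (Fin n)) (p : Fin n) (s : Finset (Fin n)) : Prop :=
  ∃ w₁ ∈ s, ∃ w₂ ∈ s, w₁ ≠ w₂ ∧ H.Adj p w₁ ∧ H.Adj p w₂

/-- The triangle `u` sees the triangle `s`: some edge of `u` sees `s`. -/
def triSees {n : ℕ} (H : SimpleGraph (Fin n)) (u s : Finset (Fin n)) : Prop :=
  ∃ a ∈ u, ∃ b ∈ u, a ≠ b ∧ sees H {a, b} s

/-- `(T, M, I)` is a tiling triple of `H`: `T` is a family of pairwise vertex-disjoint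
triangles, `M` is a matching, `I` is an independent set, and `V(T), V(M), I` partition
the vertex set. -/
def IsTilingTriple {n : ℕ} (H : SimpleGraph (Fin n)) (T M : Finset (Finset (Fin n)))
    (I : Finset (Fin n)) : Prop :=
  (∀ s ∈ T, H.IsNClique 3 s) ∧ (∀ e ∈ M, H.IsNClique 2 e) ∧
  (∀ x ∈ I, ∀ y ∈ I, ¬ H.Adj x y) ∧
  (((T ∪ M : Finset (Finset (Fin n))) : Set (Finset (Fin n))).Pairwise
    fun s₁ s₂ => Disjoint s₁ s₂) ∧
  Disjoint ((T ∪ M).biUnion id) I ∧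
  (T ∪ M).biUnion id ∪ I = Finset.univ

/-- `(T, M, I)` is a tiling triple of `H` with `(|T|, |M|)` lexicographically maximal. -/
def IsMaxTilingTriple {n : ℕ} (H : SimpleGraph (Fin n)) (T M : Finset (Finset (Fin n)))
    (I : Finset (Fin n)) : Prop :=
  IsTilingTriple H T M I ∧
  ∀ T' M' : Finset (Finset (Fin n)), ∀ I' : Finset (Fin n), IsTilingTriple H T' M' I' →
    T'.card < T.card ∨ (T'.card = T.card ∧ M'.card ≤ M.card)

/-- The number of edges of `H` between the (disjoint) vertex sets `A` and `B`. -/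
noncomputable def eBetween {n : ℕ} (H : SimpleGraph (Fin n)) (A B : Set (Fin n)) : ℕ :=
  Set.ncard {p : Fin n × Fin n | p.1 ∈ A ∧ p.2 ∈ B ∧ H.Adj p.1 p.2}

/-- `(T₁, T₂, T₃, T₄)` is an ideal partition of `T` for the tiling triple `(T, M, I)`:
`T₁` consists of the triangles of `T` seen by at least two edges of `M`; `T₂` consists of
the triangles of `T ∖ T₁` seen by at least two other members of `T`, or by one edge of
`M` and at least one vertex of `I`; and `(T₃, T₄)` arises from the greedy removal process
on `D = T ∖ (T₁ ∪ T₂)`: while some triangle of `D` sends at most `8(|D|−1)` edges to the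
other triangles of `D`, it is removed (the removed triangles, in order, form `T₃`),
and `T₄` is the final set `D`, in which every triangle sends more than `8(|T₄|−1)`
edges to the other triangles of `T₄`. -/
def IsIdealPartition {n : ℕ} (H : SimpleGraph (Fin n)) (T M : Finset (Finset (Fin n)))
    (I : Finset (Fin n)) (T₁ T₂ T₃ T₄ : Finset (Finset (Fin n))) : Prop :=
  T₁ ∪ T₂ ∪ T₃ ∪ T₄ = T ∧
  Disjoint T₁ T₂ ∧ Disjoint T₁ T₃ ∧ Disjoint T₁ T₄ ∧
  Disjoint T₂ T₃ ∧ Disjoint T₂ T₄ ∧ Disjoint T₃ T₄ ∧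
  (∀ s, s ∈ T₁ ↔ s ∈ T ∧ ∃ e₁ ∈ M, ∃ e₂ ∈ M, e₁ ≠ e₂ ∧ sees H e₁ s ∧ sees H e₂ s) ∧
  (∀ s, s ∈ T₂ ↔ s ∈ T ∧ s ∉ T₁ ∧
    ((∃ s₁ ∈ T, ∃ s₂ ∈ T, s₁ ≠ s₂ ∧ s₁ ≠ s ∧ s₂ ≠ s ∧ triSees H s₁ s ∧ triSees H s₂ s) ∨
      ((∃ e ∈ M, sees H e s) ∧ (∃ p ∈ I, vertexSees H p s)))) ∧
  (∃ k : ℕ, ∃ g : Fin k → Finset (Fin n), Function.Injective g ∧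
    Finset.image g Finset.univ = T₃ ∧
    ∀ j : Fin k,
      eBetween H (↑(g j))
          (↑((((Finset.univ.filter fun i : Fin k => j < i).image g) ∪ T₄).biUnion id))
        ≤ 8 * (k - (j : ℕ) + T₄.card - 1)) ∧
  (∀ s ∈ T₄, 8 * (T₄.card - 1) < eBetween H (↑s) (↑((T₄.erase s).biUnion id)))

/-- `x` is the critical vertex of the triangle `s` (with respect to the matching `M`):
some edge of `M` sees `x` of `s`, and every edge of `M` seeing `s` sees only `x` of `s`. -/
def IsCriticalVertex {n : ℕ} (H : SimpleGraph (Fin n)) (M : Finset (Finset (Fin n)))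
    (s : Finset (Fin n)) (x : Fin n) : Prop :=
  x ∈ s ∧ (∃ e ∈ M, seesAt H e s x) ∧ ∀ e ∈ M, ∀ w, seesAt H e s w → w = x

/-- The set of non-critical vertices of the triangles in `T₁`. -/
def nonCriticalVerts {n : ℕ} (H : SimpleGraph (Fin n)) (M T₁ : Finset (Finset (Fin n))) :
    Set (Fin n) :=
  {w | ∃ s ∈ T₁, ∃ x, IsCriticalVertex H M s x ∧ w ∈ s ∧ w ≠ x}

open Classical in
/-- The indicator of adjacency, as a natural number. -/
noncomputable def adjInd {n : ℕ} (H : SimpleGraph (Fin n)) (u v : Fin n) : ℕ :=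
  if H.Adj u v then 1 else 0

/-- The number of pairs in `A × B` that are adjacent in `H`. -/
noncomputable def adjCount {n : ℕ} (H : SimpleGraph (Fin n)) (A B : Finset (Fin n)) : ℕ :=
  ∑ u ∈ A, ∑ v ∈ B, adjInd H u v

section Counting

variable {n : ℕ} {H : SimpleGraph (Fin n)}

lemma adjInd_le_one (u v : Fin n) : adjInd H u v ≤ 1 := by
  unfold adjInd; split_ifs <;> simp

lemma adjInd_eq_zero {u v : Fin n} (h : ¬ H.Adj u v) : adjInd H u v = 0 := by
  simp [adjInd, h]

lemma adjInd_comm (u v : Fin n) : adjInd H u v = adjInd H v u := by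
  classical
  exact if_congr (H.adj_comm u v) rfl rfl

lemma adjInd_add_le_one {w u v : Fin n} (h : ¬ (H.Adj w u ∧ H.Adj w v)) :
    adjInd H w u + adjInd H w v ≤ 1 := by
  unfold adjInd; split_ifs <;> simp_all

lemma adjCount_comm (A B : Finset (Fin n)) : adjCount H A B = adjCount H B A := by
  unfold adjCount
  rw [Finset.sum_comm]
  simp_rw [adjInd_comm]

lemma adjCount_le_card_mul (A B : Finset (Fin n)) : adjCount H A B ≤ #A * #B := by
  unfold adjCount
  refine (Finset.sum_le_card_nsmul A _ #B fun u _ => ?_).trans (by simp)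
  exact (Finset.sum_le_card_nsmul B _ 1 fun v _ => adjInd_le_one u v).trans (by simp)

lemma adjCount_self_le (A : Finset (Fin n)) : adjCount H A A ≤ #A * (#A - 1) := by
  unfold adjCount
  refine (Finset.sum_le_card_nsmul A _ (#A - 1) fun u hu => ?_).trans (by simp)
  rw [← Finset.add_sum_erase A _ hu, adjInd_eq_zero (H.irrefl), zero_add,
    ← Finset.card_erase_of_mem hu]
  exact (Finset.sum_le_card_nsmul _ _ 1 fun v _ => adjInd_le_one u v).trans (by simp)

lemma two_mul_ncard_edgeSet : 2 * H.edgeSet.ncard = adjCount H univ univ := by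
  classical
  have h := H.sum_degrees_eq_twice_card_edges
  have h2 : H.edgeSet.ncard = #H.edgeFinset := by
    rw [← SimpleGraph.coe_edgeFinset, Set.ncard_coe_finset]
  rw [h2, ← h]
  unfold adjCount adjInd
  refine Finset.sum_congr rfl fun u _ => ?_
  rw [Finset.sum_boole, ← SimpleGraph.card_neighborFinset_eq_degree,
    SimpleGraph.neighborFinset_eq_filter]
  simp

/-- Summation along a partition into a disjoint family and a remainder. -/
lemma sum_univ_eq_of_partition {P : Finset (Finset (Fin n))} {I : Finset (Fin n)}
    (hP : (P : Set (Finset (Fin n))).Pairwise fun s₁ s₂ => Disjoint s₁ s₂)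
    (hd : Disjoint (P.biUnion id) I) (hu : P.biUnion id ∪ I = univ) (f : Fin n → ℕ) :
    ∑ v, f v = ∑ s ∈ P, ∑ v ∈ s, f v + ∑ v ∈ I, f v := by
  rw [← hu, Finset.sum_union hd, Finset.sum_biUnion (t := id) hP]
  rfl

/-- Expansion of the adjacency count along a vertex partition. -/
lemma adjCount_univ_eq {A B M : Finset (Finset (Fin n))} {I : Finset (Fin n)}
    (hsum : ∀ f : Fin n → ℕ, ∑ v, f v = ∑ s ∈ A, ∑ v ∈ s, f v + ∑ s ∈ B, ∑ v ∈ s, f v +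
      ∑ s ∈ M, ∑ v ∈ s, f v + ∑ v ∈ I, f v) :
    adjCount H univ univ =
      ∑ s ∈ A, ∑ s' ∈ A, adjCount H s s' + 2 * ∑ s ∈ B, ∑ s' ∈ A, adjCount H s s' +
      ∑ s ∈ B, ∑ s' ∈ B, adjCount H s s' + 2 * ∑ s ∈ A, ∑ e ∈ M, adjCount H s e +
      2 * ∑ s ∈ B, ∑ e ∈ M, adjCount H s e + 2 * ∑ s ∈ A, adjCount H s I +
      2 * ∑ s ∈ B, adjCount H s I + ∑ e ∈ M, ∑ e' ∈ M, adjCount H e e' +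
      2 * ∑ e ∈ M, adjCount H e I + adjCount H I I := by
  have key : ∀ S : Finset (Fin n), adjCount H S univ = ∑ s ∈ A, adjCount H S s +
      ∑ s ∈ B, adjCount H S s + ∑ s ∈ M, adjCount H S s + adjCount H S I := by
    intro S
    unfold adjCount
    simp_rw [hsum, Finset.sum_add_distrib]
    congr 1
    congr 1
    congr 1
    all_goals exact Finset.sum_comm
  have key2 : adjCount H univ univ = ∑ s ∈ A, adjCount H s univ +
      ∑ s ∈ B, adjCount H s univ + ∑ s ∈ M, adjCount H s univ + adjCount H I univ := by
    unfold adjCount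
    exact hsum _
  have hAB : ∑ s ∈ A, ∑ s' ∈ B, adjCount H s s' = ∑ s ∈ B, ∑ s' ∈ A, adjCount H s s' := by
    rw [Finset.sum_comm]; simp_rw [adjCount_comm]
  have hMA : ∑ s ∈ M, ∑ s' ∈ A, adjCount H s s' = ∑ s ∈ A, ∑ s' ∈ M, adjCount H s s' := by
    rw [Finset.sum_comm]; simp_rw [adjCount_comm]
  have hMB : ∑ s ∈ M, ∑ s' ∈ B, adjCount H s s' = ∑ s ∈ B, ∑ s' ∈ M, adjCount H s s' := by
    rw [Finset.sum_comm]; simp_rw [adjCount_comm]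
  have hI : ∀ F : Finset (Finset (Fin n)),
      ∑ s ∈ F, adjCount H I s = ∑ s ∈ F, adjCount H s I :=
    fun F => Finset.sum_congr rfl fun s _ => adjCount_comm _ _
  rw [key2, key I, Finset.sum_congr rfl (fun s _ => key s), Finset.sum_congr rfl (fun s _ => key s),
    Finset.sum_congr rfl (fun s _ => key s)]
  simp only [Finset.sum_add_distrib, hI, hAB, hMA, hMB]
  ring

end Counting

section Extremal

/-- The join of a clique with a complete bipartite graph whose parts are `[0, a)` and `[a, c)`. -/
def cliqueJoinBipartite (n a c : ℕ) : SimpleGraph (Fin n) where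
  Adj u v := u ≠ v ∧ ¬ (u.val < a ∧ v.val < a) ∧
    ¬ (a ≤ u.val ∧ u.val < c ∧ a ≤ v.val ∧ v.val < c)
  symm := ⟨fun _ _ h => ⟨h.1.symm, fun h' => h.2.1 ⟨h'.2, h'.1⟩,
    fun h' => h.2.2 ⟨h'.2.2.1, h'.2.2.2, h'.1, h'.2.1⟩⟩⟩
  loopless := ⟨fun _ h => h.1 rfl⟩

lemma not_hasKDisjointTriangles_cliqueJoinBipartite {n a c t : ℕ} (hn : c + t = n) :
    ¬ HasKDisjointTriangles (cliqueJoinBipartite n a c) (t + 1) := by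
  rintro ⟨T, hcard, hcl, hdis⟩
  have hex : ∀ s ∈ T, ∃ v ∈ s, c ≤ v.val := by
    intro s hs
    obtain ⟨x, y, z, hxy, hxz, hyz, rfl⟩ := SimpleGraph.is3Clique_iff.mp (hcl s hs)
    by_contra! h
    have hx := h x (by simp)
    have hy := h y (by simp)
    have hz := h z (by simp)
    obtain ⟨-, h1, h2⟩ := hxy
    obtain ⟨-, h3, h4⟩ := hxz
    obtain ⟨-, h5, h6⟩ := hyz
    omega
  have hpos : 0 < n := by
    by_contra h0
    obtain ⟨s, hs⟩ := Finset.card_pos.mp (by omega : 0 < #T)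
    obtain ⟨v, -, -⟩ := hex s hs
    exact h0 (Nat.zero_lt_of_lt v.2)
  have : Nonempty (Fin n) := ⟨⟨0, hpos⟩⟩
  choose! g hg hgc using hex
  have hinj : Set.InjOn g (T : Set (Finset (Fin n))) := by
    intro s hs s' hs' heq
    by_contra hne
    exact Finset.disjoint_left.mp (hdis hs hs' hne) (hg s hs) (heq ▸ hg s' hs')
  have hle : #T ≤ #(univ.filter fun v : Fin n => c ≤ v.val) :=
    Finset.card_le_card_of_injOn g (fun s hs => by simpa using hgc s hs) hinj
  have hC : #(univ.filter fun v : Fin n => c ≤ v.val) ≤ #(Finset.Ico c n) :=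
    Finset.card_le_card_of_injOn (fun v => v.val) (fun v hv => by simpa using hv)
      (fun u _ v _ h => Fin.ext h)
  simp at hC
  omega

lemma two_mul_ncard_cliqueJoinBipartite {n a b t : ℕ} (hn : a + b + t = n) :
    a * (b + t) + b * (a + t) + t * (n - 1) ≤
      2 * (cliqueJoinBipartite n a (a + b)).edgeSet.ncard := by
  classical
  set G := cliqueJoinBipartite n a (a + b)
  rw [two_mul_ncard_edgeSet]
  have hdeg : ∀ u : Fin n, (if u.val < a then b + t else if u.val < a + b then a + t else n - 1) ≤
      ∑ v, adjInd G u v := by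
    intro u
    have hrow : ∑ v, adjInd G u v = ∑ i ∈ Finset.range n, if i ≠ u.val ∧ ¬ (u.val < a ∧ i < a) ∧
        ¬ (a ≤ u.val ∧ u.val < a + b ∧ a ≤ i ∧ i < a + b) then 1 else 0 := by
      rw [Finset.sum_range]
      refine Finset.sum_congr rfl fun v _ => ?_
      unfold adjInd
      refine if_congr ?_ rfl rfl
      constructor
      · rintro ⟨h1, h2, h3⟩
        exact ⟨fun h => h1 (Fin.ext h.symm), h2, h3⟩
      · rintro ⟨h1, h2, h3⟩
        exact ⟨fun h => h1 (by rw [h]), h2, h3⟩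
    rw [hrow, Finset.sum_boole]
    have hu := u.2
    split_ifs with h1 h2
    · have : Finset.Ico a n ⊆ (Finset.range n).filter fun i => i ≠ u.val ∧
          ¬ (u.val < a ∧ i < a) ∧ ¬ (a ≤ u.val ∧ u.val < a + b ∧ a ≤ i ∧ i < a + b) := by
        intro i hi
        simp only [Finset.mem_Ico, Finset.mem_filter, Finset.mem_range] at hi ⊢
        omega
      have := Finset.card_le_card this
      rw [Nat.card_Ico] at this
      simp only [Nat.cast_id]
      omega
    · have : Finset.range a ∪ Finset.Ico (a + b) n ⊆ (Finset.range n).filter fun i => i ≠ u.val ∧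
          ¬ (u.val < a ∧ i < a) ∧ ¬ (a ≤ u.val ∧ u.val < a + b ∧ a ≤ i ∧ i < a + b) := by
        intro i hi
        simp only [Finset.mem_union, Finset.mem_Ico, Finset.mem_filter, Finset.mem_range] at hi ⊢
        omega
      have := Finset.card_le_card this
      rw [Finset.card_union_of_disjoint, Nat.card_Ico, Finset.card_range] at this
      · simp only [Nat.cast_id]
        omega
      · rw [Finset.disjoint_left]
        intro i
        simp only [Finset.mem_Ico, Finset.mem_range]
        omega
    · have : (Finset.range n).erase u.val ⊆ (Finset.range n).filter fun i => i ≠ u.val ∧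
          ¬ (u.val < a ∧ i < a) ∧ ¬ (a ≤ u.val ∧ u.val < a + b ∧ a ≤ i ∧ i < a + b) := by
        intro i hi
        simp only [Finset.mem_erase, Finset.mem_filter, Finset.mem_range] at hi ⊢
        omega
      have := Finset.card_le_card this
      rw [Finset.card_erase_of_mem (by simp), Finset.card_range] at this
      simpa using this
  refine le_trans ?_ (Finset.sum_le_sum fun u _ => hdeg u)
  rw [← Finset.sum_range
    (f := fun i => if i < a then b + t else if i < a + b then a + t else n - 1)]
  have hn' : n = (a + b) + t := hn.symm
  conv_rhs => rw [hn', Finset.sum_range_add, Finset.sum_range_add]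
  refine Nat.add_le_add (Nat.add_le_add ?_ ?_) ?_
  · rw [Finset.sum_congr rfl (g := fun _ => b + t)]
    · simp
    · intro i hi
      simp [Finset.mem_range.mp hi]
  · rw [Finset.sum_congr rfl (g := fun _ => a + t)]
    · simp
    · intro i hi
      simp [Finset.mem_range.mp hi]
  · rw [Finset.sum_congr rfl (g := fun _ => n - 1)]
    · simp
    · intro i hi
      simp [add_assoc, ← hn]

lemma le_two_mul_exTriangles {n a b t : ℕ} (hn : a + b + t = n) :
    a * (b + t) + b * (a + t) + t * (n - 1) ≤ 2 * exTriangles n (t + 1) := by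
  refine (two_mul_ncard_cliqueJoinBipartite hn).trans (Nat.mul_le_mul_left 2 ?_)
  refine le_csSup ⟨n * n, ?_⟩
    ⟨_, not_hasKDisjointTriangles_cliqueJoinBipartite hn, rfl⟩
  rintro m ⟨G, -, rfl⟩
  have h := adjCount_le_card_mul (H := G) univ univ
  rw [← two_mul_ncard_edgeSet] at h
  simp at h
  omega

end Extremal

/-- No family of pairwise disjoint triangles of `H` is larger than `T`. -/
def IsMaxTriangleFamily {n : ℕ} (H : SimpleGraph (Fin n)) (T : Finset (Finset (Fin n))) : Prop :=
  ∀ N : Finset (Finset (Fin n)), (∀ s ∈ N, H.IsNClique 3 s) →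
    ((N : Set (Finset (Fin n))).Pairwise fun s₁ s₂ => Disjoint s₁ s₂) → #N ≤ #T

open Classical in
/-- The vertices of `S` adjacent to every vertex of `e`. -/
noncomputable def commonNbrs {n : ℕ} (H : SimpleGraph (Fin n)) (S e : Finset (Fin n)) :
    Finset (Fin n) :=
  S.filter fun w => ∀ u ∈ e, H.Adj u w

section Exchange

variable {n : ℕ} {H : SimpleGraph (Fin n)} {T M : Finset (Finset (Fin n))} {I : Finset (Fin n)}

lemma mem_commonNbrs {S e : Finset (Fin n)} {w : Fin n} :
    w ∈ commonNbrs H S e ↔ seesAt H e S w := by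
  simp [commonNbrs, seesAt]

lemma card_commonNbrs_le (S e : Finset (Fin n)) : #(commonNbrs H S e) ≤ #S := by
  classical
  exact Finset.card_filter_le _ _

/-- Any family of disjoint triangles extends to a tiling triple. -/
lemma exists_isTilingTriple (N : Finset (Finset (Fin n))) (hN : ∀ s ∈ N, H.IsNClique 3 s)
    (hd : (N : Set (Finset (Fin n))).Pairwise fun s₁ s₂ => Disjoint s₁ s₂) :
    ∃ M I, IsTilingTriple H N M I := by
  classical
  set Good : Finset (Finset (Finset (Fin n))) := univ.filter fun M =>
    (∀ e ∈ M, H.IsNClique 2 e) ∧ ((N ∪ M : Finset (Finset (Fin n))) :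
      Set (Finset (Fin n))).Pairwise fun s₁ s₂ => Disjoint s₁ s₂ with hGood
  have hne : Good.Nonempty := ⟨∅, by simpa [hGood] using hd⟩
  obtain ⟨M, hM, hmax⟩ := Finset.exists_max_image Good Finset.card hne
  obtain ⟨hM2, hMd⟩ := (Finset.mem_filter.mp hM).2
  refine ⟨M, univ \ (N ∪ M).biUnion id, hN, hM2, ?_, hMd, Finset.disjoint_sdiff, by simp⟩
  intro x hx y hy hxy
  have hx' : ∀ s ∈ N ∪ M, x ∉ s := fun s hs hxs =>
    (Finset.mem_sdiff.mp hx).2 (Finset.mem_biUnion.mpr ⟨s, hs, hxs⟩)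
  have hy' : ∀ s ∈ N ∪ M, y ∉ s := fun s hs hys =>
    (Finset.mem_sdiff.mp hy).2 (Finset.mem_biUnion.mpr ⟨s, hs, hys⟩)
  have hnot : ({x, y} : Finset (Fin n)) ∉ M := fun h =>
    hx' _ (Finset.mem_union_right _ h) (by simp)
  have hdis : ∀ s ∈ N ∪ M, Disjoint ({x, y} : Finset (Fin n)) s := by
    intro s hs
    simp [hx' s hs, hy' s hs]
  have hmem : insert {x, y} M ∈ Good := by
    refine Finset.mem_filter.mpr ⟨Finset.mem_univ _, ?_, ?_⟩
    · intro e he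
      rcases Finset.mem_insert.mp he with rfl | he
      · rw [SimpleGraph.isNClique_iff]
        exact ⟨by simpa using fun _ => hxy, Finset.card_pair hxy.ne⟩
      · exact hM2 e he
    · rw [Finset.union_insert, Finset.coe_insert]
      exact hMd.insert fun s hs _ => ⟨hdis s hs, (hdis s hs).symm⟩
  have := hmax _ hmem
  rw [Finset.card_insert_of_notMem hnot] at this
  omega

lemma IsMaxTilingTriple.isMaxTriangleFamily (h : IsMaxTilingTriple H T M I) :
    IsMaxTriangleFamily H T := by
  intro N hN hd
  obtain ⟨M', I', h'⟩ := exists_isTilingTriple N hN hd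
  rcases h.2 N M' I' h' with h | h <;> omega

/-- Replacing the triangles of `S` by a longer list of disjoint triangles contradicts maximality. -/
lemma IsMaxTriangleFamily.exchange (hmax : IsMaxTriangleFamily H T)
    (hT : ∀ s ∈ T, H.IsNClique 3 s)
    (hd : (T : Set (Finset (Fin n))).Pairwise fun s₁ s₂ => Disjoint s₁ s₂)
    {S : Finset (Finset (Fin n))} (hS : S ⊆ T) (L : List (Finset (Fin n)))
    (hL : ∀ A ∈ L, H.IsNClique 3 A) (hLd : L.Pairwise Disjoint)
    (hLT : ∀ A ∈ L, ∀ s ∈ T, s ∉ S → Disjoint A s) : L.length ≤ #S := by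
  classical
  have hne : ∀ A ∈ L, ¬ Disjoint A A := by
    intro A hA hAA
    have := (hL A hA).card_eq
    rw [disjoint_self.mp hAA] at this
    simp at this
  have hnd : L.Nodup := by
    refine hLd.imp_of_mem fun {A B} hA _ h heq => ?_
    subst heq
    exact hne A hA h
  have hdis : Disjoint (T \ S) L.toFinset := by
    rw [Finset.disjoint_left]
    intro A hA hAL
    rw [Finset.mem_sdiff] at hA
    rw [List.mem_toFinset] at hAL
    exact hne A hAL (hLT A hAL A hA.1 hA.2)
  have hle := hmax ((T \ S) ∪ L.toFinset) ?_ ?_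
  · rw [Finset.card_union_of_disjoint hdis, List.toFinset_card_of_nodup hnd,
      Finset.card_sdiff_of_subset hS] at hle
    have := Finset.card_le_card hS
    omega
  · intro s hs
    rcases Finset.mem_union.mp hs with hs | hs
    · exact hT s (Finset.mem_sdiff.mp hs).1
    · exact hL s (List.mem_toFinset.mp hs)
  · intro s hs s' hs' hne'
    simp only [Finset.coe_union, Finset.coe_sdiff, List.coe_toFinset, Set.mem_union, Set.mem_sdiff,
      Finset.mem_coe, Set.mem_ofPred_eq] at hs hs'
    rcases hs with hs | hs <;> rcases hs' with hs' | hs'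
    · exact hd hs.1 hs'.1 hne'
    · exact (hLT s' hs' s hs.1 hs.2).symm
    · exact hLT s hs s' hs'.1 hs'.2
    · have : Std.Symm (Disjoint : Finset (Fin n) → Finset (Fin n) → Prop) :=
        ⟨fun _ _ h => h.symm⟩
      exact hLd.forall hs hs' hne'

/-- A tiling triple whose triangle family is maximum. -/
structure IsGoodTiling (H : SimpleGraph (Fin n)) (T M : Finset (Finset (Fin n)))
    (I : Finset (Fin n)) : Prop where
  tri : ∀ s ∈ T, H.IsNClique 3 s
  edge : ∀ e ∈ M, H.IsNClique 2 e
  indep : ∀ x ∈ I, ∀ y ∈ I, ¬ H.Adj x y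
  disj_tri : ∀ s ∈ T, ∀ s' ∈ T, s ≠ s' → Disjoint s s'
  disj_edge : ∀ e ∈ M, ∀ e' ∈ M, e ≠ e' → Disjoint e e'
  disj_tri_edge : ∀ s ∈ T, ∀ e ∈ M, Disjoint s e
  disj_tri_indep : ∀ s ∈ T, Disjoint s I
  disj_edge_indep : ∀ e ∈ M, Disjoint e I
  max : IsMaxTriangleFamily H T

lemma IsMaxTilingTriple.isGoodTiling (h : IsMaxTilingTriple H T M I) : IsGoodTiling H T M I := by
  have hmax := h.isMaxTriangleFamily
  obtain ⟨⟨hT, hM, hI, hd, hdI, -⟩, -⟩ := h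
  rw [Finset.disjoint_biUnion_left] at hdI
  refine ⟨hT, hM, hI, ?_, ?_, ?_, ?_, ?_, hmax⟩
  · intro s hs s' hs' hne
    exact hd (by simp [hs]) (by simp [hs']) hne
  · intro s hs s' hs' hne
    exact hd (by simp [hs]) (by simp [hs']) hne
  · intro s hs e he
    refine hd (by simp [hs]) (by simp [he]) ?_
    rintro rfl
    have h1 := (hT s hs).card_eq
    have h2 := (hM s he).card_eq
    omega
  · exact fun s hs => hdI s (by simp [hs])
  · exact fun s hs => hdI s (by simp [hs])

namespace IsGoodTiling

lemma exchange (h : IsGoodTiling H T M I)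
    {S : Finset (Finset (Fin n))} (hS : S ⊆ T) (L : List (Finset (Fin n)))
    (hL : ∀ A ∈ L, H.IsNClique 3 A) (hLd : L.Pairwise Disjoint)
    (hLT : ∀ A ∈ L, ∀ s ∈ T, s ∉ S → Disjoint A s) : L.length ≤ #S :=
  h.max.exchange h.tri (fun s hs s' hs' hne => h.disj_tri s hs s' hs' hne) hS L hL hLd hLT

lemma isNClique_insert (h : IsGoodTiling H T M I) {e s : Finset (Fin n)} {w : Fin n}
    (he : e ∈ M) (hw : seesAt H e s w) : H.IsNClique 3 (insert w e) :=
  (h.edge e he).insert fun u hu => (hw.2 u hu).symm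

lemma not_sees_edge (h : IsGoodTiling H T M I) {e : Finset (Fin n)} {p : Fin n} (he : e ∈ M)
    (hp : ∀ s ∈ T, p ∉ s) : ¬ ∀ u ∈ e, H.Adj u p := by
  intro hadj
  have := h.exchange (S := ∅) (by simp) [insert p e] (by
      simpa using (h.edge e he).insert fun u hu => (hadj u hu).symm) (by simp) (by
      simp only [List.mem_singleton, forall_eq]
      intro s hs _
      rw [Finset.disjoint_insert_left]
      exact ⟨hp s hs, (h.disj_tri_edge s hs e he).symm⟩)
  simp at this

lemma eq_of_seesAt (h : IsGoodTiling H T M I) {s e₁ e₂ : Finset (Fin n)} {w₁ w₂ : Fin n}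
    (hs : s ∈ T) (he₁ : e₁ ∈ M) (he₂ : e₂ ∈ M) (hne : e₁ ≠ e₂) (h₁ : seesAt H e₁ s w₁)
    (h₂ : seesAt H e₂ s w₂) : w₁ = w₂ := by
  by_contra hw
  have hde := h.disj_edge e₁ he₁ e₂ he₂ hne
  have hs₁ := h.disj_tri_edge s hs e₁ he₁
  have hs₂ := h.disj_tri_edge s hs e₂ he₂
  have hw₁ := h₁.1
  have hw₂ := h₂.1
  have := h.exchange (S := {s}) (by simpa using hs) [insert w₁ e₁, insert w₂ e₂] (by
      simpa using ⟨h.isNClique_insert he₁ h₁, h.isNClique_insert he₂ h₂⟩) (by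
      simp only [List.pairwise_pair, Finset.disjoint_left, Finset.mem_insert] at *
      grind) (by
      intro A hA s' hs' hne'
      have h1 := h.disj_tri s hs s' hs' (by simpa [eq_comm] using hne')
      have h2 := h.disj_tri_edge s' hs' e₁ he₁
      have h3 := h.disj_tri_edge s' hs' e₂ he₂
      simp only [Finset.disjoint_left, List.mem_cons, List.not_mem_nil] at *
      grind)
  simp at this

lemma not_indep_adj (h : IsGoodTiling H T M I) {s e : Finset (Fin n)} {x p : Fin n}
    (hs : s ∈ T) (he : e ∈ M) (hx : seesAt H e s x) (hp : p ∈ I) :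
    ¬ ∀ u ∈ s.erase x, H.Adj u p := by
  intro hadj
  have hse := h.disj_tri_edge s hs e he
  have hsI := h.disj_tri_indep s hs
  have heI := h.disj_edge_indep e he
  have hxs := hx.1
  have := h.exchange (S := {s}) (by simpa using hs) [insert x e, insert p (s.erase x)] (by
      simpa using ⟨h.isNClique_insert he hx,
        ((h.tri s hs).erase_of_mem hx.1).insert fun u hu => (hadj u hu).symm⟩) (by
      simp only [List.pairwise_pair, Finset.disjoint_left, Finset.mem_insert,
        Finset.mem_erase] at *
      grind) (by
      intro A hA s' hs' hne'
      have h1 := h.disj_tri s hs s' hs' (by simpa [eq_comm] using hne')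
      have h2 := h.disj_tri_edge s' hs' e he
      have h3 := h.disj_tri_indep s' hs'
      simp only [Finset.disjoint_left, List.mem_cons, List.not_mem_nil] at *
      grind)
  simp at this

lemma not_pair_adj (h : IsGoodTiling H T M I) {s s' e e' : Finset (Fin n)} {x x' w : Fin n}
    (hs : s ∈ T) (hs' : s' ∈ T) (hss : s ≠ s') (he : e ∈ M) (he' : e' ∈ M) (hee : e ≠ e')
    (hx : seesAt H e s x) (hx' : seesAt H e' s' x') (hw : w ∈ s.erase x) :
    ¬ ∀ u ∈ s'.erase x', H.Adj u w := by
  intro hadj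
  have d1 := h.disj_tri_edge s hs e he
  have d2 := h.disj_tri_edge s hs e' he'
  have d3 := h.disj_tri_edge s' hs' e he
  have d4 := h.disj_tri_edge s' hs' e' he'
  have d5 := h.disj_tri s hs s' hs' hss
  have d6 := h.disj_edge e he e' he' hee
  have hxs := hx.1
  have hxs' := hx'.1
  have hc : #({s, s'} : Finset (Finset (Fin n))) = 2 := Finset.card_pair hss
  have := h.exchange (S := {s, s'}) (by simp [Finset.insert_subset_iff, hs, hs'])
    [insert x e, insert x' e', insert w (s'.erase x')] (by
      simpa using ⟨h.isNClique_insert he hx, h.isNClique_insert he' hx',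
        ((h.tri s' hs').erase_of_mem hx'.1).insert fun u hu => (hadj u hu).symm⟩) (by
      simp only [List.pairwise_cons, List.mem_cons, List.not_mem_nil, Finset.disjoint_left,
        Finset.mem_insert, Finset.mem_erase] at *
      grind) (by
      intro A hA r hr hne'
      simp only [Finset.mem_insert, Finset.mem_singleton, not_or] at hne'
      have h1 := h.disj_tri s hs r hr (Ne.symm hne'.1)
      have h2 := h.disj_tri s' hs' r hr (Ne.symm hne'.2)
      have h3 := h.disj_tri_edge r hr e he
      have h4 := h.disj_tri_edge r hr e' he'
      simp only [Finset.disjoint_left, List.mem_cons, List.not_mem_nil, Finset.mem_erase] at *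
      grind)
  simp [hc] at this

lemma eq_of_pairs_see (h : IsGoodTiling H T M I) {s s₁ s₂ e₁ e₂ : Finset (Fin n)}
    {x₁ x₂ w₁ w₂ : Fin n} (hs : s ∈ T) (hs₁ : s₁ ∈ T) (hs₂ : s₂ ∈ T) (h01 : s ≠ s₁)
    (h02 : s ≠ s₂) (h12 : s₁ ≠ s₂) (he₁ : e₁ ∈ M) (he₂ : e₂ ∈ M) (hee : e₁ ≠ e₂)
    (hx₁ : seesAt H e₁ s₁ x₁) (hx₂ : seesAt H e₂ s₂ x₂)
    (hw₁ : seesAt H (s₁.erase x₁) s w₁) (hw₂ : seesAt H (s₂.erase x₂) s w₂) : w₁ = w₂ := by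
  by_contra hw
  have c1 := hx₁.1
  have c2 := hx₂.1
  have c3 := hw₁.1
  have c4 := hw₂.1
  have hc : #({s, s₁, s₂} : Finset (Finset (Fin n))) = 3 := by
    rw [Finset.card_eq_three]
    exact ⟨s, s₁, s₂, h01, h02, h12, rfl⟩
  have d1 := h.disj_tri_edge s hs e₁ he₁
  have d2 := h.disj_tri_edge s hs e₂ he₂
  have d3 := h.disj_tri_edge s₁ hs₁ e₁ he₁
  have d4 := h.disj_tri_edge s₁ hs₁ e₂ he₂
  have d5 := h.disj_tri_edge s₂ hs₂ e₁ he₁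
  have d6 := h.disj_tri_edge s₂ hs₂ e₂ he₂
  have d7 := h.disj_tri s hs s₁ hs₁ h01
  have d8 := h.disj_tri s hs s₂ hs₂ h02
  have d9 := h.disj_tri s₁ hs₁ s₂ hs₂ h12
  have d10 := h.disj_edge e₁ he₁ e₂ he₂ hee
  have := h.exchange (S := {s, s₁, s₂}) (by simp [Finset.insert_subset_iff, hs, hs₁, hs₂])
    [insert x₁ e₁, insert x₂ e₂, insert w₁ (s₁.erase x₁), insert w₂ (s₂.erase x₂)] (by
      simpa using ⟨h.isNClique_insert he₁ hx₁, h.isNClique_insert he₂ hx₂,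
        ((h.tri s₁ hs₁).erase_of_mem hx₁.1).insert fun u hu => (hw₁.2 u hu).symm,
        ((h.tri s₂ hs₂).erase_of_mem hx₂.1).insert fun u hu => (hw₂.2 u hu).symm⟩) (by
      clear hw₁ hw₂ hx₁ hx₂
      simp only [List.pairwise_cons, List.mem_cons, List.not_mem_nil, Finset.disjoint_left,
        Finset.mem_insert, Finset.mem_erase] at *
      grind) (by
      intro A hA r hr hne'
      simp only [Finset.mem_insert, Finset.mem_singleton, not_or] at hne'
      have h1 := h.disj_tri s hs r hr (Ne.symm hne'.1)
      have h2 := h.disj_tri s₁ hs₁ r hr (Ne.symm hne'.2.1)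
      have h3 := h.disj_tri s₂ hs₂ r hr (Ne.symm hne'.2.2)
      have h4 := h.disj_tri_edge r hr e₁ he₁
      have h5 := h.disj_tri_edge r hr e₂ he₂
      clear hw₁ hw₂ hx₁ hx₂
      simp only [Finset.disjoint_left, List.mem_cons, List.not_mem_nil] at *
      grind)
  simp [hc] at this

end IsGoodTiling

end Exchange

section PairCounts

variable {n : ℕ} {H : SimpleGraph (Fin n)} {T M : Finset (Finset (Fin n))} {I : Finset (Fin n)}

lemma adjCount_pair_le {S e : Finset (Fin n)} (he : #e = 2) :
    adjCount H S e ≤ #S + #(commonNbrs H S e) := by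
  classical
  unfold adjCount commonNbrs
  rw [Finset.card_filter, Finset.card_eq_sum_ones, ← Finset.sum_add_distrib]
  refine Finset.sum_le_sum fun w _ => ?_
  obtain ⟨u, v, huv, rfl⟩ := Finset.card_eq_two.mp he
  rw [Finset.sum_pair huv]
  split_ifs with h
  · exact Nat.add_le_add (adjInd_le_one _ _) (adjInd_le_one _ _)
  · exact adjInd_add_le_one (fun h' => h (by simpa [H.adj_comm] using h'))

lemma adjCount_pair_le_card {S e : Finset (Fin n)} (he : #e = 2)
    (h : ∀ w ∈ S, ¬ ∀ u ∈ e, H.Adj u w) : adjCount H S e ≤ #S := by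
  refine (adjCount_pair_le he).trans ?_
  have : commonNbrs H S e = ∅ := by
    rw [Finset.eq_empty_iff_forall_notMem]
    intro w hw
    exact h w (mem_commonNbrs.mp hw).1 (mem_commonNbrs.mp hw).2
  simp [this]

lemma adjCount_erase_right {S s : Finset (Fin n)} {x : Fin n} (hx : x ∈ s) :
    adjCount H S s = adjCount H S {x} + adjCount H S (s.erase x) := by
  unfold adjCount
  rw [← Finset.sum_add_distrib]
  refine Finset.sum_congr rfl fun u _ => ?_
  rw [Finset.sum_singleton, Finset.add_sum_erase _ _ hx]

lemma adjCount_erase_left {S s : Finset (Fin n)} {x : Fin n} (hx : x ∈ s) :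
    adjCount H s S = adjCount H {x} S + adjCount H (s.erase x) S := by
  rw [adjCount_comm, adjCount_erase_right hx, adjCount_comm {x}, adjCount_comm (s.erase x)]

/-- If at most one element is witnessed by the whole family, the witness sets are small in total. -/
lemma sum_card_le_card_add_two {α β : Type*} [DecidableEq α] {F : Finset α} {W : α → Finset β}
    (hF : F.Nonempty) (hW : ∀ a ∈ F, #(W a) ≤ 3)
    (heq : ∀ a ∈ F, ∀ b ∈ F, a ≠ b → ∀ v ∈ W a, ∀ w ∈ W b, v = w) :
    ∑ a ∈ F, #(W a) ≤ #F + 2 := by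
  by_cases h : ∃ a ∈ F, 2 ≤ #(W a)
  · obtain ⟨a, ha, h2⟩ := h
    obtain ⟨v, hv, w, hw, hvw⟩ := Finset.one_lt_card.mp h2
    rw [← Finset.add_sum_erase F _ ha, Finset.sum_eq_zero, add_zero]
    · have := hW a ha
      have := hF.card_pos
      omega
    · intro b hb
      rw [Finset.mem_erase] at hb
      rw [Finset.card_eq_zero, Finset.eq_empty_iff_forall_notMem]
      intro z hz
      exact hvw ((heq a ha b hb.2 hb.1.symm v hv z hz).trans
        (heq a ha b hb.2 hb.1.symm w hw z hz).symm)
  · push Not at h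
    have := Finset.sum_le_card_nsmul F (fun a => #(W a)) 1 fun a ha => Nat.le_of_lt_succ (h a ha)
    simp at this
    omega

lemma sum_card_le_three {α β : Type*} [DecidableEq α] {F : Finset α} {W : α → Finset β}
    (hW : ∀ a ∈ F, #(W a) ≤ 3)
    (heq : ∀ a ∈ F, ∀ b ∈ F, (W a).Nonempty → (W b).Nonempty → a = b) :
    ∑ a ∈ F, #(W a) ≤ 3 := by
  by_cases h : ∃ a ∈ F, (W a).Nonempty
  · obtain ⟨a, ha, h2⟩ := h
    rw [← Finset.add_sum_erase F _ ha, Finset.sum_eq_zero, add_zero]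
    · exact hW a ha
    · intro b hb
      rw [Finset.mem_erase] at hb
      rw [Finset.card_eq_zero]
      by_contra hne
      exact hb.1 (heq b hb.2 a ha (Finset.nonempty_iff_ne_empty.mpr hne) h2)
  · push Not at h
    rw [Finset.sum_eq_zero]
    · simp
    · intro a ha
      simp [h a ha]

/-- Two different edges of `M` see the vertex `x` of `s`, and no edge of `M` sees another
vertex of `s`. -/
structure IsStronglyCritical (H : SimpleGraph (Fin n)) (M : Finset (Finset (Fin n)))
    (s : Finset (Fin n)) (x : Fin n) : Prop where
  exists_two : ∃ e₁ ∈ M, ∃ e₂ ∈ M, e₁ ≠ e₂ ∧ seesAt H e₁ s x ∧ seesAt H e₂ s x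
  unique : ∀ e ∈ M, ∀ w, seesAt H e s w → w = x

lemma IsStronglyCritical.mem {s : Finset (Fin n)} {x : Fin n} (hx : IsStronglyCritical H M s x) :
    x ∈ s := by
  obtain ⟨e, -, -, -, -, h, -⟩ := hx.exists_two
  exact h.1

lemma IsStronglyCritical.exists_ne {s : Finset (Fin n)} {x : Fin n}
    (hx : IsStronglyCritical H M s x) (e : Finset (Fin n)) :
    ∃ e' ∈ M, e ≠ e' ∧ seesAt H e' s x := by
  obtain ⟨e₁, he₁, e₂, he₂, hne, h₁, h₂⟩ := hx.exists_two
  by_cases h : e = e₁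
  · exact ⟨e₂, he₂, h ▸ hne, h₂⟩
  · exact ⟨e₁, he₁, h, h₁⟩

lemma IsStronglyCritical.exists_pair {s s' : Finset (Fin n)} {x x' : Fin n}
    (hx : IsStronglyCritical H M s x) (hx' : IsStronglyCritical H M s' x') :
    ∃ e ∈ M, ∃ e' ∈ M, e ≠ e' ∧ seesAt H e s x ∧ seesAt H e' s' x' := by
  obtain ⟨e, he, -, -, -, h, -⟩ := hx.exists_two
  obtain ⟨e', he', hne, h'⟩ := hx'.exists_ne e
  exact ⟨e, he, e', he', hne, h, h'⟩

namespace IsGoodTiling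

lemma exists_isStronglyCritical (h : IsGoodTiling H T M I) {s : Finset (Fin n)} (hs : s ∈ T)
    (hsee : ∃ e₁ ∈ M, ∃ e₂ ∈ M, e₁ ≠ e₂ ∧ sees H e₁ s ∧ sees H e₂ s) :
    ∃ x, IsStronglyCritical H M s x := by
  obtain ⟨e₁, he₁, e₂, he₂, hne, ⟨x, h₁⟩, ⟨x', h₂⟩⟩ := hsee
  obtain rfl := h.eq_of_seesAt hs he₁ he₂ hne h₁ h₂
  refine ⟨x, ⟨e₁, he₁, e₂, he₂, hne, h₁, h₂⟩, fun e he w hw => ?_⟩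
  by_cases hee : e = e₁
  · exact h.eq_of_seesAt hs he he₂ (hee ▸ hne) hw h₂
  · exact h.eq_of_seesAt hs he he₁ hee hw h₁

lemma card_erase (h : IsGoodTiling H T M I) {s : Finset (Fin n)} {x : Fin n} (hs : s ∈ T)
    (hx : x ∈ s) : #(s.erase x) = 2 := by
  rw [Finset.card_erase_of_mem hx, (h.tri s hs).card_eq]

lemma adjCount_edge_edge (h : IsGoodTiling H T M I) {e e' : Finset (Fin n)} (he : e ∈ M)
    (he' : e' ∈ M) : adjCount H e e' ≤ 2 := by
  rw [← (h.edge e he).card_eq]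
  refine adjCount_pair_le_card (h.edge e' he').card_eq fun w hw => h.not_sees_edge he' ?_
  exact fun s hs hws => Finset.disjoint_left.mp (h.disj_tri_edge s hs e he) hws hw

lemma adjCount_edge_indep (h : IsGoodTiling H T M I) {e : Finset (Fin n)} (he : e ∈ M) :
    adjCount H e I ≤ #I := by
  rw [adjCount_comm]
  refine adjCount_pair_le_card (h.edge e he).card_eq fun w hw => h.not_sees_edge he ?_
  exact fun s hs hws => Finset.disjoint_left.mp (h.disj_tri_indep s hs) hws hw

lemma adjCount_indep (h : IsGoodTiling H T M I) : adjCount H I I = 0 :=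
  Finset.sum_eq_zero fun x hx => Finset.sum_eq_zero fun y hy => adjInd_eq_zero (h.indep x hx y hy)

lemma adjCount_tri_edge (h : IsGoodTiling H T M I) {s e : Finset (Fin n)} (hs : s ∈ T)
    (he : e ∈ M) : adjCount H s e ≤ 3 + #(commonNbrs H s e) :=
  (adjCount_pair_le (h.edge e he).card_eq).trans (by rw [(h.tri s hs).card_eq])

lemma adjCount_critical_indep (h : IsGoodTiling H T M I) {s : Finset (Fin n)} {x : Fin n}
    (hs : s ∈ T) (hx : IsStronglyCritical H M s x) : adjCount H s I ≤ 2 * #I := by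
  obtain ⟨e, he, -, -, -, hex, -⟩ := hx.exists_two
  have h1 := adjCount_le_card_mul (H := H) I {x}
  have h2 : adjCount H I (s.erase x) ≤ #I :=
    adjCount_pair_le_card (h.card_erase hs hx.mem) fun p hp => h.not_indep_adj hs he hex hp
  rw [adjCount_comm, adjCount_erase_right hx.mem]
  simp at h1
  omega

lemma adjCount_critical_critical (h : IsGoodTiling H T M I) {s s' : Finset (Fin n)}
    {x x' : Fin n} (hs : s ∈ T) (hs' : s' ∈ T) (hne : s ≠ s') (hx : IsStronglyCritical H M s x)
    (hx' : IsStronglyCritical H M s' x') : adjCount H s s' ≤ 7 := by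
  obtain ⟨e, he, e', he', hee, hex, hex'⟩ := hx.exists_pair hx'
  have c := h.card_erase hs hx.mem
  have c' := h.card_erase hs' hx'.mem
  have h1 := adjCount_le_card_mul (H := H) s {x'}
  have h2 := adjCount_le_card_mul (H := H) {x} (s'.erase x')
  have h3 : adjCount H (s.erase x) (s'.erase x') ≤ #(s.erase x) :=
    adjCount_pair_le_card c' fun w hw => h.not_pair_adj hs hs' hne he he' hee hex hex' hw
  rw [adjCount_erase_right hx'.mem, adjCount_erase_left (S := s'.erase x') hx.mem]
  rw [(h.tri s hs).card_eq] at h1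
  rw [c'] at h2
  simp at h1 h2
  omega

lemma sum_adjCount_critical (h : IsGoodTiling H T M I) {T₁ : Finset (Finset (Fin n))}
    (hT₁ : T₁ ⊆ T) (hne : T₁.Nonempty) (hc : ∀ s ∈ T₁, ∃ x, IsStronglyCritical H M s x)
    {s : Finset (Fin n)} (hs : s ∈ T) (hs₁ : s ∉ T₁) :
    ∑ s' ∈ T₁, adjCount H s s' ≤ 7 * #T₁ + 2 := by
  obtain ⟨s₀, hs₀⟩ := hne
  have : Nonempty (Fin n) := ⟨(hc s₀ hs₀).choose⟩
  choose! x hx using hc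
  have h1 : ∀ s' ∈ T₁, adjCount H s s' ≤ 6 + #(commonNbrs H s (s'.erase (x s'))) := by
    intro s' hs'
    have h1 := adjCount_le_card_mul (H := H) s {x s'}
    have h2 := adjCount_pair_le (H := H) (S := s) (h.card_erase (hT₁ hs') (hx s' hs').mem)
    rw [adjCount_erase_right (hx s' hs').mem]
    rw [(h.tri s hs).card_eq] at h1 h2
    simp at h1
    omega
  have h2 : ∑ s' ∈ T₁, #(commonNbrs H s (s'.erase (x s'))) ≤ #T₁ + 2 := by
    refine sum_card_le_card_add_two ⟨s₀, hs₀⟩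
      (fun s' _ => (card_commonNbrs_le _ _).trans (h.tri s hs).card_eq.le) ?_
    intro s₁ h₁ s₂ h₂ h12 w₁ hw₁ w₂ hw₂
    obtain ⟨e, he, e', he', hee, hex, hex'⟩ := (hx s₁ h₁).exists_pair (hx s₂ h₂)
    exact h.eq_of_pairs_see hs (hT₁ h₁) (hT₁ h₂) (fun h' => hs₁ (h' ▸ h₁))
      (fun h' => hs₁ (h' ▸ h₂)) h12 he he' hee hex hex' (mem_commonNbrs.mp hw₁)
      (mem_commonNbrs.mp hw₂)
  have h3 := Finset.sum_le_sum h1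
  rw [Finset.sum_add_distrib, Finset.sum_const, smul_eq_mul] at h3
  omega

lemma sum_adjCount_edge_of_not (h : IsGoodTiling H T M I) {s : Finset (Fin n)} (hs : s ∈ T)
    (hsee : ¬ ∃ e₁ ∈ M, ∃ e₂ ∈ M, e₁ ≠ e₂ ∧ sees H e₁ s ∧ sees H e₂ s) :
    ∑ e ∈ M, adjCount H s e ≤ 3 * #M + 3 := by
  have h1 := Finset.sum_le_sum fun e he => h.adjCount_tri_edge hs (e := e) he
  have h2 : ∑ e ∈ M, #(commonNbrs H s e) ≤ 3 := by
    refine sum_card_le_three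
      (fun s' _ => (card_commonNbrs_le _ _).trans (h.tri s hs).card_eq.le) ?_
    rintro a ha b hb ⟨v, hv⟩ ⟨w, hw⟩
    by_contra hab
    exact hsee ⟨a, ha, b, hb, hab, ⟨v, mem_commonNbrs.mp hv⟩, ⟨w, mem_commonNbrs.mp hw⟩⟩
  rw [Finset.sum_add_distrib, Finset.sum_const, smul_eq_mul] at h1
  omega

open Classical in
lemma sum_adjCount_edge_critical (h : IsGoodTiling H T M I) {s : Finset (Fin n)} {x : Fin n}
    (hs : s ∈ T) (hx : IsStronglyCritical H M s x) :
    ∑ e ∈ M, adjCount H s e ≤ 3 * #M + #(M.filter fun e => sees H e s) := by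
  have h1 : ∀ e ∈ M, adjCount H s e ≤ 3 + if sees H e s then 1 else 0 := by
    intro e he
    refine (h.adjCount_tri_edge hs he).trans (Nat.add_le_add_left ?_ 3)
    have hsub : commonNbrs H s e ⊆ {x} := fun w hw =>
      Finset.mem_singleton.mpr (hx.unique e he w (mem_commonNbrs.mp hw))
    split_ifs with hse
    · simpa using Finset.card_le_card hsub
    · rw [Nat.le_zero, Finset.card_eq_zero, Finset.eq_empty_iff_forall_notMem]
      exact fun w hw => hse ⟨w, mem_commonNbrs.mp hw⟩
  refine (Finset.sum_le_sum h1).trans ?_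
  rw [Finset.sum_add_distrib, Finset.sum_const, smul_eq_mul, Finset.card_filter, mul_comm]

end IsGoodTiling

end PairCounts

section Numeric

lemma edge_count_contradiction {n t m i k r c E : ℝ} (hcard : n = 3 * k + 3 * r + 2 * m + i)
    (hlow : (n ^ 2 - t ^ 2) / 2 - 1 / 2 + t * (n - 1) + 4 ≤ E)
    (hup : E ≤ 7 * k * (k - 1) + 6 * k + 2 * (r * (7 * k + 2)) + 9 * r ^ 2 +
      2 * (4 * m * k - 3 * (m - c)) + 2 * (r * (3 * m + 3)) + 4 * (k * i) + 6 * (r * i) +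
      2 * m ^ 2 + 2 * (m * i))
    (hkr : (k = t - 1 ∧ (r = 0 ∨ r = 1 ∨ r = 2)) ∨ (k = t ∧ (r = 0 ∨ r = 1)) ∨
      (k = t + 1 ∧ r = 0))
    (ht₀ : 0 ≤ t) (ht : t ≤ (2 * n - 6) / 9 + 1) (hi : i ≤ n / 1000)
    (hc : c ≤ n / 1000) (hn : 10000 ≤ n) : False := by
  obtain rfl : m = (n - 3 * k - 3 * r - i) / 2 := by linarith
  rcases hkr with ⟨rfl, rfl | rfl | rfl⟩ | ⟨rfl, rfl | rfl⟩ | ⟨rfl, rfl⟩ <;>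
    nlinarith [sq_nonneg i]

end Numeric

section Assembly

variable {n : ℕ} {H : SimpleGraph (Fin n)} {T M T₁ : Finset (Finset (Fin n))} {I : Finset (Fin n)}

lemma IsMaxTilingTriple.sum_eq (h : IsMaxTilingTriple H T M I) (hT₁ : T₁ ⊆ T) (f : Fin n → ℕ) :
    ∑ v, f v = ∑ s ∈ T₁, ∑ v ∈ s, f v + ∑ s ∈ T \ T₁, ∑ v ∈ s, f v +
      ∑ s ∈ M, ∑ v ∈ s, f v + ∑ v ∈ I, f v := by
  obtain ⟨⟨hT, hM, -, hd, hdI, hu⟩, -⟩ := h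
  have hTM : Disjoint T M := by
    rw [Finset.disjoint_left]
    intro s hs hs'
    have h1 := (hT s hs).card_eq
    have h2 := (hM s hs').card_eq
    omega
  rw [sum_univ_eq_of_partition hd hdI hu, Finset.sum_union hTM, ← Finset.sum_sdiff hT₁]
  ring

lemma IsMaxTilingTriple.card_eq (h : IsMaxTilingTriple H T M I) (hT₁ : T₁ ⊆ T) :
    n = 3 * #T₁ + 3 * #(T \ T₁) + 2 * #M + #I := by
  have hT := h.1.1
  have hM := h.1.2.1
  have := h.sum_eq hT₁ fun _ => 1
  simp only [Finset.sum_const, smul_eq_mul, mul_one, Finset.card_univ, Fintype.card_fin] at this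
  rw [Finset.sum_congr rfl fun s hs => (hT s (hT₁ hs)).card_eq,
    Finset.sum_congr rfl fun s hs => (hT s (Finset.mem_sdiff.mp hs).1).card_eq,
    Finset.sum_congr rfl fun s hs => (hM s hs).card_eq] at this
  simp only [Finset.sum_const, smul_eq_mul] at this
  omega

open Classical in
lemma IsMaxTilingTriple.two_mul_ncard_edgeSet_le (h : IsMaxTilingTriple H T M I) (hT₁ : T₁ ⊆ T)
    (hmem : ∀ s, s ∈ T₁ ↔ s ∈ T ∧ ∃ e₁ ∈ M, ∃ e₂ ∈ M, e₁ ≠ e₂ ∧ sees H e₁ s ∧ sees H e₂ s)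
    (hne : T₁.Nonempty) :
    2 * H.edgeSet.ncard ≤ 7 * #T₁ * (#T₁ - 1) + 6 * #T₁ + 2 * (#(T \ T₁) * (7 * #T₁ + 2)) +
      9 * #(T \ T₁) ^ 2 +
      2 * (3 * #M * #T₁ + ∑ s ∈ T₁, #(M.filter fun e => sees H e s)) +
      2 * (#(T \ T₁) * (3 * #M + 3)) + 4 * (#T₁ * #I) + 6 * (#(T \ T₁) * #I) +
      2 * #M ^ 2 + 2 * (#M * #I) := by
  have hg := h.isGoodTiling
  have hc : ∀ s ∈ T₁, ∃ x, IsStronglyCritical H M s x := fun s hs =>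
    hg.exists_isStronglyCritical (hT₁ hs) ((hmem s).mp hs).2
  have hB : ∀ s ∈ T \ T₁, s ∈ T ∧ s ∉ T₁ := fun s hs => Finset.mem_sdiff.mp hs
  have b1 : ∑ s ∈ T₁, ∑ s' ∈ T₁, adjCount H s s' ≤ #T₁ * (6 + 7 * (#T₁ - 1)) := by
    rw [← smul_eq_mul]
    refine Finset.sum_le_card_nsmul _ _ _ fun s hs => ?_
    obtain ⟨x, hx⟩ := hc s hs
    rw [← Finset.add_sum_erase _ _ hs]
    refine Nat.add_le_add ?_ ?_
    · have := adjCount_self_le (H := H) s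
      rwa [(hg.tri s (hT₁ hs)).card_eq] at this
    · rw [← Finset.card_erase_of_mem hs, mul_comm, ← smul_eq_mul]
      refine Finset.sum_le_card_nsmul _ _ _ fun s' hs' => ?_
      rw [Finset.mem_erase] at hs'
      obtain ⟨x', hx'⟩ := hc s' hs'.2
      exact hg.adjCount_critical_critical (hT₁ hs) (hT₁ hs'.2) hs'.1.symm hx hx'
  have b2 : ∑ s ∈ T \ T₁, ∑ s' ∈ T₁, adjCount H s s' ≤ #(T \ T₁) * (7 * #T₁ + 2) := by
    rw [← smul_eq_mul]
    exact Finset.sum_le_card_nsmul _ _ _ fun s hs =>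
      hg.sum_adjCount_critical hT₁ hne hc (hB s hs).1 (hB s hs).2
  have b3 : ∑ s ∈ T \ T₁, ∑ s' ∈ T \ T₁, adjCount H s s' ≤ #(T \ T₁) * (#(T \ T₁) * 9) := by
    rw [← smul_eq_mul]
    refine Finset.sum_le_card_nsmul _ _ _ fun s hs => ?_
    rw [← smul_eq_mul]
    refine Finset.sum_le_card_nsmul _ _ _ fun s' hs' => ?_
    have := adjCount_le_card_mul (H := H) s s'
    rwa [(hg.tri s (hB s hs).1).card_eq, (hg.tri s' (hB s' hs').1).card_eq] at this
  have b4 : ∑ s ∈ T₁, ∑ e ∈ M, adjCount H s e ≤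
      3 * #M * #T₁ + ∑ s ∈ T₁, #(M.filter fun e => sees H e s) := by
    refine (Finset.sum_le_sum fun s hs => ?_).trans (b := ∑ s ∈ T₁, (3 * #M +
      #(M.filter fun e => sees H e s))) ?_
    · obtain ⟨x, hx⟩ := hc s hs
      exact hg.sum_adjCount_edge_critical (hT₁ hs) hx
    · rw [Finset.sum_add_distrib, Finset.sum_const, smul_eq_mul, mul_comm]
  have b5 : ∑ s ∈ T \ T₁, ∑ e ∈ M, adjCount H s e ≤ #(T \ T₁) * (3 * #M + 3) := by
    rw [← smul_eq_mul]
    exact Finset.sum_le_card_nsmul _ _ _ fun s hs =>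
      hg.sum_adjCount_edge_of_not (hB s hs).1 fun h' =>
        (hB s hs).2 ((hmem s).mpr ⟨(hB s hs).1, h'⟩)
  have b6 : ∑ s ∈ T₁, adjCount H s I ≤ #T₁ * (2 * #I) := by
    rw [← smul_eq_mul]
    refine Finset.sum_le_card_nsmul _ _ _ fun s hs => ?_
    obtain ⟨x, hx⟩ := hc s hs
    exact hg.adjCount_critical_indep (hT₁ hs) hx
  have b7 : ∑ s ∈ T \ T₁, adjCount H s I ≤ #(T \ T₁) * (3 * #I) := by
    rw [← smul_eq_mul]
    refine Finset.sum_le_card_nsmul _ _ _ fun s hs => ?_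
    have := adjCount_le_card_mul (H := H) s I
    rwa [(hg.tri s (hB s hs).1).card_eq] at this
  have b8 : ∑ e ∈ M, ∑ e' ∈ M, adjCount H e e' ≤ #M * (#M * 2) := by
    rw [← smul_eq_mul]
    refine Finset.sum_le_card_nsmul _ _ _ fun e he => ?_
    rw [← smul_eq_mul]
    exact Finset.sum_le_card_nsmul _ _ _ fun e' he' => hg.adjCount_edge_edge he he'
  have b9 : ∑ e ∈ M, adjCount H e I ≤ #M * #I := by
    rw [← smul_eq_mul]
    exact Finset.sum_le_card_nsmul _ _ _ fun e he => hg.adjCount_edge_indep he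
  rw [two_mul_ncard_edgeSet, adjCount_univ_eq (h.sum_eq hT₁), hg.adjCount_indep]
  have e1 : #T₁ * (6 + 7 * (#T₁ - 1)) = 7 * #T₁ * (#T₁ - 1) + 6 * #T₁ := by ring
  nlinarith

/-- A rainbow graph with many disjoint triangles yields a rainbow family of triangles. -/
lemma card_lt_of_not_hasRainbowKTriangles {χ : Sym2 (Fin n) → ℕ} {k : ℕ}
    (hχ : ¬ HasRainbowKTriangles (⊤ : SimpleGraph (Fin n)) χ k) (hH : Set.InjOn χ H.edgeSet)
    (hT : ∀ s ∈ T, H.IsNClique 3 s)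
    (hd : (T : Set (Finset (Fin n))).Pairwise fun s₁ s₂ => Disjoint s₁ s₂) : #T < k := by
  by_contra! hle
  obtain ⟨N, hNT, hN⟩ := Finset.exists_subset_card_eq hle
  refine hχ ⟨N, hN, fun s hs => (hT s (hNT hs)).mono le_top,
    hd.mono (Finset.coe_subset.mpr hNT), hH.mono ?_⟩
  rintro e ⟨hdiag, s, hs, he⟩
  induction e with
  | _ u v =>
    exact (hT s (hNT hs)).isClique (he u (by simp)) (he v (by simp)) (by simpa using hdiag)

/-- A quadratic lower bound for the maximum number of edges without `t + 1` disjoint triangles. -/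
lemma le_two_mul_exTriangles_real {n t : ℕ} (ht : t ≤ n) :
    ((n : ℝ) ^ 2 - t ^ 2) / 2 - 1 / 2 + t * (n - 1) ≤ 2 * exTriangles n (t + 1) := by
  rcases Nat.eq_zero_or_pos n with rfl | hn
  · obtain rfl : t = 0 := by omega
    have : (0 : ℝ) ≤ exTriangles 0 (0 + 1) := Nat.cast_nonneg _
    norm_num
    linarith
  obtain ⟨a, b, hab, h⟩ : ∃ a b, a + b + t = n ∧ (b = a ∨ b = a + 1) :=
    ⟨(n - t) / 2, (n - t) - (n - t) / 2, by omega, by omega⟩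
  have hex := le_two_mul_exTriangles hab
  have hex' : ((a * (b + t) + b * (a + t) + t * (n - 1) : ℕ) : ℝ) ≤
      ((2 * exTriangles n (t + 1) : ℕ) : ℝ) := Nat.cast_le.mpr hex
  push_cast [Nat.cast_sub (show 1 ≤ n from hn)] at hex'
  have hn' : (n : ℝ) = a + b + t := by exact_mod_cast hab.symm
  rcases h with rfl | rfl
  · rw [hn'] at hex' ⊢
    nlinarith
  · push_cast at hn' hex'
    rw [hn'] at hex' ⊢
    nlinarith

lemma sum_le_of_three_small {α : Type*} [DecidableEq α] {F B : Finset α} {f : α → ℕ} {m : ℕ}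
    {c : ℝ} (hBF : B ⊆ F) (hB : 3 ≤ #B) (hf : ∀ a ∈ F, f a ≤ m) (hc : ∀ a ∈ B, (f a : ℝ) ≤ c)
    (hcm : c ≤ m) : ((∑ a ∈ F, f a : ℕ) : ℝ) ≤ m * #F - 3 * (m - c) := by
  have h1 : (∑ a ∈ F \ B, f a : ℝ) ≤ #(F \ B) * m := by
    rw [← nsmul_eq_mul]
    exact Finset.sum_le_card_nsmul _ _ _ fun a ha =>
      Nat.cast_le.mpr (hf a (Finset.mem_sdiff.mp ha).1)
  have h2 : (∑ a ∈ B, f a : ℝ) ≤ #B * c := by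
    rw [← nsmul_eq_mul]
    exact Finset.sum_le_card_nsmul _ _ _ hc
  have h3 : (#(F \ B) : ℝ) + #B = #F := by
    exact_mod_cast Finset.card_sdiff_add_card_eq_card hBF
  have h4 : (3 : ℝ) ≤ #B := by exact_mod_cast hB
  push_cast
  rw [← Finset.sum_sdiff hBF]
  nlinarith [mul_nonneg (sub_nonneg.mpr h4) (sub_nonneg.mpr hcm)]

end Assembly

/-- Claim 4.7. Under the stability conclusions, for every
`0 < ε ≤ 10⁻³`, at most two triangles of `T₁` are seen by fewer than `εn` edges of `M`. -/
theorem statement15 (δ : ℝ) (hδ : 0 < δ) (ε : ℝ) (hε₀ : 0 < ε) (hε₁ : ε ≤ 1 / 1000) :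
    ∃ N₀ : ℕ, ∀ n : ℕ, N₀ ≤ n → ∀ t : ℕ,
      δ * n ≤ t → (t : ℝ) ≤ (2 * n - 6) / 9 + 1 →
      ∀ χ : Sym2 (Fin n) → ℕ,
        IsSurjColoring n (exTriangles n (t + 1) + 2) χ →
        ¬ HasRainbowKTriangles (⊤ : SimpleGraph (Fin n)) χ (t + 2) →
        ∀ H : SimpleGraph (Fin n), IsRepGraph χ (exTriangles n (t + 1) + 2) H →
        ∀ (T M : Finset (Finset (Fin n))) (I : Finset (Fin n)),
          IsMaxTilingTriple H T M I →
          ∀ T₁ T₂ T₃ T₄ : Finset (Finset (Fin n)),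
            IsIdealPartition H T M I T₁ T₂ T₃ T₄ →
            (t - 1 ≤ T₁.card ∧ T₁.card ≤ t + 1) →
            (((n : ℝ) - 3 * (t + 1)) / 2 - Real.sqrt (2 * n) / 2 < M.card ∧
              (M.card : ℝ) ≤ ((n : ℝ) - 3 * (t + 1)) / 2) →
            (I.card : ℝ) < Real.sqrt (2 * n) →
            Set.ncard {s : Finset (Fin n) | s ∈ T₁ ∧
              ((Set.ncard {e : Finset (Fin n) | e ∈ M ∧ sees H e s} : ℝ) < ε * n)} ≤ 2 := by

  classical
  refine ⟨10000000, ?_⟩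
  intro n hn t htδ ht χ _ hrain H hrep T M I hmax T₁ T₂ T₃ T₄ hideal hT₁card _ hI
  obtain ⟨hunion, -, -, -, -, -, -, hmem, -⟩ := hideal
  have hn7 : (10000000 : ℝ) ≤ n := by exact_mod_cast hn
  have ht1 : 1 ≤ t := by
    have : (0 : ℝ) < t := lt_of_lt_of_le (by positivity) htδ
    exact_mod_cast this
  have htn : t ≤ n := by
    have : (t : ℝ) ≤ n := by linarith
    exact_mod_cast this
  have hT₁ : T₁ ⊆ T := fun s hs => ((hmem s).mp hs).1
  by_contra! hbad
  set B := T₁.filter fun s => (#(M.filter fun e => sees H e s) : ℝ) < ε * n with hBdef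
  have hBset : {s : Finset (Fin n) | s ∈ T₁ ∧
      ((Set.ncard {e : Finset (Fin n) | e ∈ M ∧ sees H e s} : ℝ) < ε * n)} = B := by
    ext s
    have : {e : Finset (Fin n) | e ∈ M ∧ sees H e s} = (M.filter fun e => sees H e s) := by
      ext e
      simp
    rw [Finset.mem_coe, hBdef, Finset.mem_filter, ← Set.ncard_coe_finset, ← this]
    rfl
  rw [hBset, Set.ncard_coe_finset] at hbad
  have hBT : B ⊆ T₁ := Finset.filter_subset _ _
  have hne : T₁.Nonempty := Finset.card_pos.mp (by have := Finset.card_le_card hBT; omega)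
  have hTcard : #T < t + 2 := card_lt_of_not_hasRainbowKTriangles hrain hrep.2 hmax.1.1
    fun s hs s' hs' hss => hmax.isGoodTiling.disj_tri s hs s' hs' hss
  have hr : #(T \ T₁) + #T₁ = #T := Finset.card_sdiff_add_card_eq_card hT₁
  have hcard := hmax.card_eq hT₁
  have hup := hmax.two_mul_ncard_edgeSet_le hT₁ hmem hne
  have hlow := le_two_mul_exTriangles_real htn
  have hcardR : (n : ℝ) = 3 * #T₁ + 3 * #(T \ T₁) + 2 * #M + #I := by exact_mod_cast hcard
  have hIn : (#I : ℝ) ≤ n / 1000 := by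
    refine hI.le.trans (Real.sqrt_le_iff.mpr ⟨by positivity, ?_⟩)
    nlinarith
  have hεn : ε * n ≤ n / 1000 := by nlinarith
  have hTR : (#T₁ : ℝ) + #(T \ T₁) ≤ t + 1 := by
    exact_mod_cast (show #T₁ + #(T \ T₁) ≤ t + 1 by omega)
  have hsum : ((∑ s ∈ T₁, #(M.filter fun e => sees H e s) : ℕ) : ℝ) ≤
      #M * #T₁ - 3 * (#M - ε * n) :=
    sum_le_of_three_small hBT hbad (fun s _ => Finset.card_filter_le _ _)
      (fun s hs => (Finset.mem_filter.mp hs).2.le) (by linarith)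
  have hupR : ((2 * H.edgeSet.ncard : ℕ) : ℝ) ≤ _ := Nat.cast_le.mpr hup
  rw [hrep.1] at hupR
  push_cast [Nat.cast_sub hne.card_pos] at hupR hsum
  refine edge_count_contradiction (E := 2 * ((exTriangles n (t + 1) : ℝ) + 2)) (c := ε * n)
    (t := t) hcardR (by linarith) (by linarith) ?_ (by positivity) ht hIn hεn (by linarith)
  have hk : (#T₁ + 1 = t ∧ (#(T \ T₁) = 0 ∨ #(T \ T₁) = 1 ∨ #(T \ T₁) = 2)) ∨
      (#T₁ = t ∧ (#(T \ T₁) = 0 ∨ #(T \ T₁) = 1)) ∨ (#T₁ = t + 1 ∧ #(T \ T₁) = 0) := by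
    omega
  rw [eq_sub_iff_add_eq]
  exact_mod_cast hk
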